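/- Let k be a field of characteristic p > 0, A a commutative k-algebra, and D, E two derivations of A that commute: D∘E = E∘D. Then (D+E)^p = D^p + E^p as maps A → A. More generally, for any a ∈ A the map (aD)^p − a^p D^p − (aD)^{p−1}(a)·D annihilates... (restricted version): if D is a derivation then for a ∈ A, (aD)^p = a^p D^p + ((aD)^{p-1}(a))·D as operators on A. -/

import Mathlib

namespace Derivation

open Finset Polynomial

section CommRing

variable {R A B : Type*} [CommRing R] [CommRing A] [Algebra R A] [CommRing B] [Algebra R B]

/-- The general Leibniz rule for iterates of a derivation. -/
theorem iterate_apply_mul (D : Derivation R A A) (n : ℕ) (x y : A) :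
    D^[n] (x * y) = ∑ ij ∈ antidiagonal n, n.choose ij.1 • (D^[ij.1] x * D^[ij.2] y) := by
  induction n with
  | zero => simp
  | succ n ih =>
    rw [sum_antidiagonal_choose_succ_nsmul (M := A) (fun i j => D^[i] x * D^[j] y) n]
    simp only [Function.iterate_succ_apply', ih, map_sum, map_nsmul, leibniz, smul_eq_mul, smul_add,
      sum_add_distrib, add_right_inj]
    refine sum_congr rfl fun ⟨i, j⟩ hij ↦ ?_
    rw [n.choose_symm_of_eq_add (mem_antidiagonal.1 hij).symm, mul_comm]

/-- In characteristic `p`, the `p`-th iterate of a derivation satisfies the Leibniz rule. -/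
theorem iterate_char_apply_mul (D : Derivation R A A) (p : ℕ) [hp : Fact p.Prime] [CharP A p]
    (x y : A) : D^[p] (x * y) = x * D^[p] y + y * D^[p] x := by
  rw [iterate_apply_mul, Nat.sum_antidiagonal_eq_sum_range_succ_mk, sum_range_succ,
    ← Nat.succ_pred_eq_of_pos hp.out.pos, sum_range_succ', Nat.succ_pred_eq_of_pos hp.out.pos,
    sum_eq_zero]
  · simp [mul_comm]
  · intro i hi
    have hlt : i + 1 < p := Nat.add_lt_of_lt_sub (mem_range.1 hi)
    rw [nsmul_eq_mul, (CharP.cast_eq_zero_iff A p _).2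
      (hp.out.dvd_choose_self i.succ_ne_zero hlt), zero_mul]

/-- In characteristic `p`, the `p`-th iterate of a derivation as a derivation. -/
def iterateChar (D : Derivation R A A) (p : ℕ) [Fact p.Prime] [CharP A p] : Derivation R A A :=
  mk' ((D : Module.End R A) ^ p) fun x y ↦ by
    simpa [Module.End.pow_apply] using D.iterate_char_apply_mul p x y

@[simp]
theorem iterateChar_apply (D : Derivation R A A) (p : ℕ) [Fact p.Prime] [CharP A p] (x : A) :
    D.iterateChar p x = D^[p] x := by
  simp [iterateChar, Module.End.pow_apply]

/-- The coefficient of `D ^ j` in the expansion of `(a • D) ^ n`. -/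
def smulPowCoeff (D : Derivation R A A) (a : A) : ℕ → ℕ → A
  | 0, 0 => 1
  | 0, _ + 1 => 0
  | n + 1, 0 => a * D (smulPowCoeff D a n 0)
  | n + 1, j + 1 => a * (D (smulPowCoeff D a n (j + 1)) + smulPowCoeff D a n j)

theorem smulPowCoeff_eq_zero_of_lt (D : Derivation R A A) (a : A) {n j : ℕ} (h : n < j) :
    D.smulPowCoeff a n j = 0 := by
  induction n generalizing j with
  | zero => cases j <;> simp_all [smulPowCoeff]
  | succ n ih =>
    cases j with
    | zero => simp at h
    | succ j => simp [smulPowCoeff, ih (show n < j by lia), ih (show n < j + 1 by lia)]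

theorem smulPowCoeff_self (D : Derivation R A A) (a : A) (n : ℕ) :
    D.smulPowCoeff a n n = a ^ n := by
  induction n with
  | zero => simp [smulPowCoeff]
  | succ n ih => simp [smulPowCoeff, ih, smulPowCoeff_eq_zero_of_lt, pow_succ']

theorem smulPowCoeff_succ_zero (D : Derivation R A A) (a : A) (n : ℕ) :
    D.smulPowCoeff a (n + 1) 0 = 0 := by
  induction n with
  | zero => simp [smulPowCoeff]
  | succ n ih => rw [smulPowCoeff, ih, map_zero, mul_zero]

theorem smulPowCoeff_succ_one (D : Derivation R A A) (a : A) (n : ℕ) :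
    D.smulPowCoeff a (n + 1) 1 = (a • D)^[n] a := by
  induction n with
  | zero => simp [smulPowCoeff]
  | succ n ih =>
    rw [smulPowCoeff, ih, smulPowCoeff_succ_zero, Function.iterate_succ_apply']
    simp

/-- The expansion of the iterates of `f a • D'`, where `D'` extends `D` along `f`. -/
theorem iterate_smul_apply (D : Derivation R A A) (D' : Derivation R B B) (f : A →+* B)
    (hf : ∀ x, D' (f x) = f (D x)) (a : A) (n : ℕ) (y : B) :
    (f a • D')^[n] y = ∑ j ∈ range (n + 1), f (D.smulPowCoeff a n j) * D'^[j] y := by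
  induction n with
  | zero => simp [smulPowCoeff]
  | succ n ih =>
    have hlast : D.smulPowCoeff a n (n + 1) = 0 := smulPowCoeff_eq_zero_of_lt D a n.lt_succ_self
    have hshift : ∑ j ∈ range (n + 1), f a * f (D (D.smulPowCoeff a n (j + 1))) * D'^[j + 1] y
        + f a * f (D (D.smulPowCoeff a n 0)) * D'^[0] y
        = ∑ j ∈ range (n + 1), f a * f (D (D.smulPowCoeff a n j)) * D'^[j] y := by
      rw [← sum_range_succ' fun j ↦ f a * f (D (D.smulPowCoeff a n j)) * D'^[j] y,
        sum_range_succ, hlast]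
      simp
    rw [Function.iterate_succ_apply', ih, sum_range_succ' _ (n + 1)]
    simp only [smulPowCoeff, map_mul, map_add, mul_add, add_mul, sum_add_distrib]
    rw [add_right_comm, hshift, ← sum_add_distrib, map_sum]
    refine sum_congr rfl fun j _ ↦ ?_
    simp only [smul_apply, smul_eq_mul, leibniz, hf, Function.iterate_succ_apply']
    ring

/-- The extension of a derivation of `A` to `A[X]` that sends `X` to `1`. -/
noncomputable def polynomialExtension (D : Derivation R A A) : Derivation R A[X] A[X] :=
  PolynomialModule.equivPolynomialSelf.compDer D.mapCoeffs + derivative'.restrictScalars R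

theorem polynomialExtension_C (D : Derivation R A A) (x : A) :
    D.polynomialExtension (C x) = C (D x) := by
  simp [polynomialExtension]

theorem polynomialExtension_X (D : Derivation R A A) : D.polynomialExtension X = 1 := by
  simp [polynomialExtension]

theorem iterate_polynomialExtension_X_pow (D : Derivation R A A) (m j : ℕ) :
    D.polynomialExtension^[j] (X ^ m) = (m.descFactorial j : A[X]) * X ^ (m - j) := by
  induction j with
  | zero => simp
  | succ j ih =>
    rw [Function.iterate_succ_apply', ih, leibniz, leibniz_pow, polynomialExtension_X,
      map_natCast, Nat.descFactorial_succ]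
    simp [Nat.sub_sub]
    ring

/-- In characteristic `p`, only the first and last coefficients of `(a • D) ^ p` survive. -/
theorem smulPowCoeff_char_eq_zero (D : Derivation R A A) (a : A) (p : ℕ) [hp : Fact p.Prime]
    [CharP A p] {m : ℕ} (hm : 1 < m) (hmp : m < p) : D.smulPowCoeff a p m = 0 := by
  have hexp := iterate_smul_apply D D.polynomialExtension C D.polynomialExtension_C a p (X ^ m)
  rw [← iterateChar_apply, leibniz_pow] at hexp
  have heval := congrArg (eval 0) hexp
  simp only [iterate_polynomialExtension_X_pow, eval_finsetSum] at heval
  rw [sum_eq_single_of_mem m (mem_range.2 (by lia))] at heval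
  · have hfact : IsUnit (m.factorial : A) := by
      rw [CharP.isUnit_natCast_iff hp.out, hp.out.dvd_factorial]
      lia
    simp [Nat.descFactorial_self, (show m - 1 ≠ 0 by lia)] at heval
    exact (hfact.mul_left_eq_zero).1 heval.symm
  · intro j _ hj
    rcases hj.lt_or_gt with h | h
    · simp [(show m - j ≠ 0 by lia)]
    · simp [Nat.descFactorial_of_lt h]

/-- Hochschild's formula for the `p`-th power of `a • D` in characteristic `p`. -/
theorem iterate_char_smul_apply (D : Derivation R A A) (a : A) (p : ℕ) [hp : Fact p.Prime]
    [CharP A p] (x : A) :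
    (a • D)^[p] x = a ^ p * D^[p] x + (a • D)^[p - 1] a * D x := by
  have hpos : p - 1 + 1 = p := Nat.sub_add_cancel hp.out.pos
  have hexp := iterate_smul_apply D D (RingHom.id A) (fun _ ↦ rfl) a p x
  simp only [RingHom.id_apply] at hexp
  rw [hexp, sum_range_succ, smulPowCoeff_self, add_comm, ← smulPowCoeff_succ_one, hpos,
    sum_eq_single_of_mem 1 (mem_range.2 hp.out.one_lt), Function.iterate_one]
  intro j hj hj1
  rcases j with _ | j
  · rw [← hpos, smulPowCoeff_succ_zero, zero_mul]
  · rw [D.smulPowCoeff_char_eq_zero a p (by lia) (mem_range.1 hj), zero_mul]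

end CommRing

end Derivation

/-- Jacobson's formula in the commutative case: over a field `k` of
characteristic `p > 0`, if `D` and `E` are commuting derivations of a
commutative `k`-algebra `A`, then `(D + E)^p = D^p + E^p` as maps `A → A`;
moreover for any `a ∈ A`, `(a • D)^p = a^p • D^p + ((a • D)^[p-1] a) • D`
as operators on `A`. -/
theorem derivation_add_pow_char (k : Type*) [Field k] (p : ℕ) [CharP k p] (hp : 0 < p)
    (A : Type*) [CommRing A] [Algebra k A] (D E : Derivation k A A)
    (hcomm : (D : Module.End k A) * (E : Module.End k A)
      = (E : Module.End k A) * (D : Module.End k A)) :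
    (((D + E : Derivation k A A) : Module.End k A)) ^ p
      = (D : Module.End k A) ^ p + (E : Module.End k A) ^ p ∧
    (∀ a : A,
      (((a • D : Derivation k A A) : Module.End k A)) ^ p
        = a ^ p • (D : Module.End k A) ^ p
          + (((((a • D : Derivation k A A) : Module.End k A)) ^ (p - 1)) a)
            • (D : Module.End k A)) := by
  rcases subsingleton_or_nontrivial A with hA | hA
  · exact ⟨Subsingleton.elim _ _, fun a ↦ Subsingleton.elim _ _⟩
  have hprime : Fact p.Prime := ⟨(CharP.char_is_prime_or_zero k p).resolve_right hp.ne'⟩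
  have hchar : CharP A p := charP_of_injective_algebraMap (algebraMap k A).injective p
  have hchar' : CharP (Module.End k A) p :=
    charP_of_injective_algebraMap (algebraMap k (Module.End k A)).injective p
  refine ⟨?_, fun a ↦ LinearMap.ext fun x ↦ ?_⟩
  · rw [Derivation.coe_add_linearMap]
    exact add_pow_char_of_commute p hcomm
  · simpa [Module.End.pow_apply] using D.iterate_char_smul_apply a p x
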